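/- In the first-last conformant manipulation construction from exact perfect bipartite matching: given a bipartite graph G on vertex parts A = {a₁,…,a_n}, B = {b₁,…,b_n}, red edge set E' ⊆ E(G), and integer k ≤ n+1, construct the first-last election with candidates A ∪ B ∪ D ∪ {p} (D containing dummies d₁^{ij},…,d_{n+1}^{ij} for each edge (a_i,b_j)), vertex voters giving each a_i one point and each b_i minus one point, and for each edge a cyclic chain of n+3 voters (if red) or n+2 voters (if not red) whose total contribution to every candidate is 0, as in the paper's construction, with n(n+1)+k manipulators. Then the manipulators can cast votes from the nonmanipulator votes making p a first-last winner if and only if G has a perfect matching containing exactly k red edges. -/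

import Mathlib

/-- Candidates for the first-last conformant manipulation construction:
`inl i` is the vertex candidate `a_i ∈ A`, `inr (inl j)` is `b_j ∈ B`,
`inr (inr (inl ((i,j), t)))` is the dummy `d_{t+1}^{ij}` (for each potential
edge `(a_i, b_j)` and `t < n + 1`), and `inr (inr (inr ()))` is `p`. -/
abbrev Cand14 (n : ℕ) :=
  Fin n ⊕ Fin n ⊕ (Fin n × Fin n) × Fin (n + 1) ⊕ Unit

/-- Since first-last only consumes the top and bottom candidates of each
vote, a vote is modeled as a pair (top candidate, bottom candidate). -/
abbrev Vote14 (n : ℕ) := Cand14 n × Cand14 n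

def aC {n : ℕ} (i : Fin n) : Cand14 n := Sum.inl i
def bC {n : ℕ} (j : Fin n) : Cand14 n := Sum.inr (Sum.inl j)
def dC {n : ℕ} (e : Fin n × Fin n) (t : Fin (n + 1)) : Cand14 n :=
  Sum.inr (Sum.inr (Sum.inl (e, t)))
def pC (n : ℕ) : Cand14 n := Sum.inr (Sum.inr (Sum.inr ()))

/-- The chain of `n + 3` voters for a red edge `e = (i, j)`:
`b_j > ⋯ > d₁`, `d_t > ⋯ > d_{t+1}` for `t = 1, …, n`, `d_{n+1} > ⋯ > a_i`,
and `a_i > ⋯ > b_j`. -/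
def redChain {n : ℕ} (e : Fin n × Fin n) : Multiset (Vote14 n) :=
  {(bC e.2, dC e 0)} +
    (Finset.univ : Finset (Fin n)).val.map
      (fun t => (dC e t.castSucc, dC e t.succ)) +
    {(dC e (Fin.last n), aC e.1), (aC e.1, bC e.2)}

/-- The chain of `n + 2` voters for a non-red edge `e = (i, j)`:
`b_j > ⋯ > d₁`, `d_t > ⋯ > d_{t+1}` for `t = 1, …, n - 1`, `d_n > ⋯ > a_i`,
and `a_i > ⋯ > b_j`. -/
def plainChain {n : ℕ} (e : Fin n × Fin n) : Multiset (Vote14 n) :=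
  {(bC e.2, dC e 0)} +
    ((Finset.univ.filter (fun t : Fin n => t.1 + 1 < n)).val.map
      (fun t => (dC e t.castSucc, dC e t.succ))) +
    {(dC e ⟨n - 1, by omega⟩, aC e.1), (aC e.1, bC e.2)}

/-- The nonmanipulator votes: vertex voters `a_i > ⋯ > b_i` for each `i`, and
for each edge of `E` the corresponding chain (red chains for edges in `E'`). -/
def votes14 {n : ℕ} (E E' : Finset (Fin n × Fin n)) : Multiset (Vote14 n) :=
  (Finset.univ : Finset (Fin n)).val.map (fun i => (aC i, bC i)) +
    E.val.bind (fun e => if e ∈ E' then redChain e else plainChain e)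

/-- The first-last score of candidate `c`: `+1` for each vote with `c` on
top, `-1` for each vote with `c` at the bottom. -/
def flScore14 {n : ℕ} (V : Multiset (Vote14 n)) (c : Cand14 n) : ℤ :=
  (V.countP (fun v => v.1 = c) : ℤ) - (V.countP (fun v => v.2 = c) : ℤ)


def dN14 {n : ℕ} (e : Fin n × Fin n) (t : ℕ) : Cand14 n := dC e (Fin.ofNat (n + 1) t)

lemma dN_inj {n : ℕ} {e e' : Fin n × Fin n} {t t' : ℕ} (h : t ≤ n) (h' : t' ≤ n) :
    (dN14 e t = dN14 e' t') ↔ (e = e' ∧ t = t') := by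
  simp only [dN14, dC, Sum.inr.injEq, Sum.inl.injEq, Prod.mk.injEq, Fin.ext_iff, Fin.ofNat]
  rw [Nat.mod_eq_of_lt (by omega), Nat.mod_eq_of_lt (by omega)]

lemma aC_inj {n : ℕ} {i j : Fin n} : (aC i = aC j) ↔ i = j := by simp [aC]
lemma bC_inj {n : ℕ} {i j : Fin n} : (bC i = bC j) ↔ i = j := by simp [bC]
lemma ab_ne {n : ℕ} {i j : Fin n} : (aC i = bC j) ↔ False := by simp [aC, bC]
lemma ba_ne {n : ℕ} {i j : Fin n} : (bC i = aC j) ↔ False := by simp [aC, bC]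
lemma ad_ne {n : ℕ} {i : Fin n} {e t} : (aC i = dN14 e t) ↔ False := by simp [aC, dN14, dC]
lemma da_ne {n : ℕ} {i : Fin n} {e t} : (dN14 e t = aC i) ↔ False := by simp [aC, dN14, dC]
lemma bd_ne {n : ℕ} {i : Fin n} {e t} : (bC i = dN14 e t) ↔ False := by simp [bC, dN14, dC]
lemma db_ne {n : ℕ} {i : Fin n} {e t} : (dN14 e t = bC i) ↔ False := by simp [bC, dN14, dC]

def path14 {n : ℕ} (L : ℕ) (e : Fin n × Fin n) : Multiset (Vote14 n) :=
  {(bC e.2, dN14 e 0)} +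
    (Finset.range L).val.map (fun t => (dN14 e t, dN14 e (t + 1))) +
    {(dN14 e L, aC e.1)}

def chain14 {n : ℕ} (L : ℕ) (e : Fin n × Fin n) : Multiset (Vote14 n) :=
  path14 L e + {(aC e.1, bC e.2)}

def len14 {n : ℕ} (E' : Finset (Fin n × Fin n)) (e : Fin n × Fin n) : ℕ :=
  if e ∈ E' then n else n - 1

lemma len_le {n : ℕ} (E' : Finset (Fin n × Fin n)) (e) : len14 E' e ≤ n := by
  unfold len14; split_ifs <;> omega

lemma filter_chain {n : ℕ} (e : Fin n × Fin n) (L : ℕ) (hL : L ≤ n) :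
    ((Finset.univ.filter (fun t : Fin n => t.1 < L)).val.map
      (fun t => (dC e t.castSucc, dC e t.succ))) =
    (Finset.range L).val.map (fun t => (dN14 e t, dN14 e (t + 1))) := by
  have h1 : Finset.range L =
      (Finset.univ.filter (fun t : Fin n => t.1 < L)).map Fin.valEmbedding := by
    ext x
    simp only [Finset.mem_range, Finset.mem_map, Finset.mem_filter, Finset.mem_univ, true_and,
      Fin.valEmbedding_apply]
    constructor
    · intro h; exact ⟨⟨x, by omega⟩, h, rfl⟩
    · rintro ⟨y, hy, rfl⟩; exact hy
  rw [h1, Finset.map_val, Multiset.map_map]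
  apply Multiset.map_congr rfl
  intro t _
  have h2 : t.castSucc = Fin.ofNat (n + 1) t.1 := by
    ext; simp [Fin.ofNat, Nat.mod_eq_of_lt (show t.1 < n + 1 by omega)]
  have h3 : t.succ = Fin.ofNat (n + 1) (t.1 + 1) := by
    ext; simp only [Fin.ofNat, Fin.val_succ]; rw [Nat.mod_eq_of_lt (by omega)]
  simp only [Function.comp, Fin.valEmbedding_apply, dN14]
  rw [h2, h3]

lemma d_zero {n : ℕ} (e : Fin n × Fin n) : dC e 0 = dN14 e 0 := by
  simp [dN14]

lemma d_mk {n : ℕ} (e : Fin n × Fin n) (t : Fin (n + 1)) : dC e t = dN14 e t.1 := by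
  simp [dN14]

lemma red_eq {n : ℕ} (e : Fin n × Fin n) : redChain e = chain14 n e := by
  have h := filter_chain e n le_rfl
  rw [Finset.filter_true_of_mem (by intro x _; exact x.2)] at h
  unfold redChain chain14 path14
  rw [h, d_zero, d_mk e (Fin.last n), Fin.val_last, add_assoc _ {(dN14 e n, aC e.1)}]
  rfl

lemma plain_eq {n : ℕ} (e : Fin n × Fin n) : plainChain e = chain14 (n - 1) e := by
  have h := filter_chain e (n - 1) (by omega)
  have h2 : (Finset.univ.filter (fun t : Fin n => t.1 + 1 < n)) =
      (Finset.univ.filter (fun t : Fin n => t.1 < n - 1)) := by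
    ext t; simp only [Finset.mem_filter, Finset.mem_univ, true_and]; omega
  unfold plainChain chain14 path14
  rw [h2, h, d_zero, d_mk e ⟨n - 1, _⟩, add_assoc _ {(dN14 e (n - 1), aC e.1)}]
  rfl

lemma votes_eq {n : ℕ} (E E' : Finset (Fin n × Fin n)) : votes14 E E' =
    (Finset.univ : Finset (Fin n)).val.map (fun i => (aC i, bC i)) +
    E.val.bind (fun e => chain14 (len14 E' e) e) := by
  unfold votes14
  congr 2
  funext e
  unfold len14
  split_ifs
  · exact red_eq e
  · exact plain_eq e

lemma mem_votes {n : ℕ} {E E' : Finset (Fin n × Fin n)} {v : Vote14 n} :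
    v ∈ votes14 E E' ↔ (∃ i, v = (aC i, bC i)) ∨ ∃ e ∈ E, v = (bC e.2, dN14 e 0) ∨
      (∃ t < len14 E' e, v = (dN14 e t, dN14 e (t + 1))) ∨ v = (dN14 e (len14 E' e), aC e.1) ∨
      v = (aC e.1, bC e.2) := by
  rw [votes_eq]
  simp [chain14, path14, eq_comm, or_assoc, and_or_left, exists_or]

lemma score_add {n : ℕ} (V W : Multiset (Vote14 n)) (c) :
    flScore14 (V + W) c = flScore14 V c + flScore14 W c := by
  simp only [flScore14, Multiset.countP_add]; push_cast; ring

lemma score_zero {n : ℕ} (c : Cand14 n) : flScore14 0 c = 0 := by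
  simp [flScore14]

lemma score_single {n : ℕ} (v : Vote14 n) (c) :
    flScore14 {v} c = (if v.1 = c then 1 else 0) - (if v.2 = c then 1 else 0) := by
  simp [flScore14, ← Multiset.cons_zero, Multiset.countP_cons]

lemma score_map {n : ℕ} {ι : Type*} (s : Finset ι) (f : ι → Vote14 n) (c) :
    flScore14 (s.val.map f) c = ∑ i ∈ s, flScore14 {f i} c := by
  classical
  induction s using Finset.induction_on with
  | empty => simp [score_zero]
  | insert a s ha ih =>
    rw [Finset.insert_val_of_notMem ha, Multiset.map_cons, ← Multiset.singleton_add, score_add, ih,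
      Finset.sum_insert ha]

lemma score_bind {n : ℕ} {ι : Type*} (s : Finset ι) (f : ι → Multiset (Vote14 n)) (c) :
    flScore14 (s.val.bind f) c = ∑ i ∈ s, flScore14 (f i) c := by
  classical
  induction s using Finset.induction_on with
  | empty => simp [score_zero]
  | insert a s ha ih =>
    rw [Finset.insert_val_of_notMem ha, Multiset.cons_bind, score_add, ih,
      Finset.sum_insert ha]

lemma score_path {n : ℕ} (L : ℕ) (e : Fin n × Fin n) (c) :
    flScore14 (path14 L e) c = (if bC e.2 = c then 1 else 0) - (if aC e.1 = c then 1 else 0) := by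
  unfold path14
  rw [score_add, score_add, score_map]
  simp only [score_single]
  rw [Finset.sum_range_sub' (fun t => if dN14 e t = c then (1 : ℤ) else 0)]
  ring

lemma card_path {n : ℕ} (L : ℕ) (e : Fin n × Fin n) : Multiset.card (path14 L e) = L + 2 := by
  simp [path14]

lemma score_votes {n : ℕ} (E E' : Finset (Fin n × Fin n)) (c) :
    flScore14 (votes14 E E') c =
      ∑ i : Fin n, ((if aC i = c then (1 : ℤ) else 0) - (if bC i = c then 1 else 0)) := by
  rw [votes_eq, score_add, score_map, score_bind]
  simp only [chain14, score_add, score_path, score_single]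
  simp

lemma sum_countP {α ι : Type*} (W : Multiset α) (s : Finset ι) (P : α → Prop) (Q : ι → α → Prop)
    [DecidablePred P] [∀ i, DecidablePred (Q i)]
    (h : ∀ v ∈ W, (if P v then 1 else 0) = ∑ i ∈ s, if Q i v then 1 else 0) :
    W.countP P = ∑ i ∈ s, W.countP (Q i) := by
  induction W using Multiset.induction_on with
  | empty => simp
  | cons a W ih =>
    simp only [Multiset.countP_cons, Finset.sum_add_distrib]
    rw [ih (fun v hv => h v (Multiset.mem_cons_of_mem hv)), h a (Multiset.mem_cons_self a W)]

/-- the sum of all scores is zero -/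
lemma score_sum {n : ℕ} (V : Multiset (Vote14 n)) : ∑ c, flScore14 V c = 0 := by
  induction V using Multiset.induction_on with
  | empty => simp [score_zero]
  | cons a V ih =>
    simp only [← Multiset.singleton_add, score_add, Finset.sum_add_distrib, ih, score_single]
    simp

/-- In the first-last conformant manipulation construction from
exact perfect bipartite matching (bipartite graph with parts of size `n`,
edge set `E`, red edges `E' ⊆ E`, and `k ≤ n + 1`), the `n(n+1) + k`
manipulators can cast votes from the nonmanipulator votes making `p` a
first-last winner iff the graph has a perfect matching containing exactly `k`
red edges. -/
theorem stmt_14 (n k : ℕ) (hn : 0 < n) (hk : k ≤ n + 1)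
    (E E' : Finset (Fin n × Fin n)) (hE' : E' ⊆ E) :
    (∃ W : Multiset (Vote14 n), Multiset.card W = n * (n + 1) + k ∧
        (∀ v ∈ W, v ∈ votes14 E E') ∧
        ∀ c : Cand14 n,
          flScore14 (votes14 E E' + W) c ≤ flScore14 (votes14 E E' + W) (pC n))
      ↔ (∃ F ⊆ E,
          (∀ i : Fin n, (F.filter (fun e => e.1 = i)).card = 1) ∧
          (∀ j : Fin n, (F.filter (fun e => e.2 = j)).card = 1) ∧
          (F ∩ E').card = k) := by
  have hmain : ∀ W : Multiset (Vote14 n), (∀ v ∈ W, v ∈ votes14 E E') →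
      ((∀ c : Cand14 n,
          flScore14 (votes14 E E' + W) c ≤ flScore14 (votes14 E E' + W) (pC n)) ↔
        ∀ c, flScore14 (votes14 E E') c + flScore14 W c = 0) := by
    intro W hW
    have hp : flScore14 (votes14 E E' + W) (pC n) = 0 := by
      have h1 : ∀ v ∈ votes14 E E' + W, ¬ v.1 = pC n ∧ ¬ v.2 = pC n := by
        intro v hv
        have : v ∈ votes14 E E' := by
          rcases Multiset.mem_add.1 hv with h | h
          exacts [h, hW v h]
        rw [mem_votes] at this
        rcases this with ⟨i, rfl⟩ | ⟨e, he, rfl | ⟨t, ht, rfl⟩ | rfl | rfl⟩ <;>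
          simp [pC, aC, bC, dN14, dC]
      unfold flScore14
      rw [Multiset.countP_eq_zero.2 (fun v hv => (h1 v hv).1),
        Multiset.countP_eq_zero.2 (fun v hv => (h1 v hv).2)]
      simp
    rw [hp]
    constructor
    · intro h c
      rw [← score_add]
      exact (Finset.sum_eq_zero_iff_of_nonpos (fun c _ => h c)).1 (score_sum _) c
        (Finset.mem_univ c)
    · intro h c
      rw [score_add, h c]
  have sA : ∀ i : Fin n, flScore14 (votes14 E E') (aC i) = 1 := by
    intro i; rw [score_votes]; simp [aC_inj, ba_ne]
  have sB : ∀ i : Fin n, flScore14 (votes14 E E') (bC i) = -1 := by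
    intro i; rw [score_votes]; simp [bC_inj, ab_ne]
  have sD : ∀ e t, flScore14 (votes14 E E') (dN14 e t) = 0 := by
    intro e t; rw [score_votes]; simp [ad_ne, bd_ne]
  constructor
  · rintro ⟨W, hcard, hW, hs⟩
    rw [hmain W hW] at hs
    have hL := len_le E'
    have hA : ∀ i, W.countP (fun v => v.2 = aC i) = W.countP (fun v => v.1 = aC i) + 1 := by
      intro i; have := hs (aC i); rw [sA] at this; unfold flScore14 at this; omega
    have hB : ∀ i, W.countP (fun v => v.1 = bC i) = W.countP (fun v => v.2 = bC i) + 1 := by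
      intro i; have := hs (bC i); rw [sB] at this; unfold flScore14 at this; omega
    have hD : ∀ e t, W.countP (fun v => v.1 = dN14 e t) = W.countP (fun v => v.2 = dN14 e t) := by
      intro e t; have := hs (dN14 e t); rw [sD] at this; unfold flScore14 at this; omega
    have hW' := fun v hv => mem_votes.1 (hW v hv)
    obtain ⟨x, hx⟩ : ∃ x : Fin n × Fin n → ℕ,
      ∀ e, x e = W.countP (fun v => v.1 = dN14 e 0) := ⟨_, fun _ => rfl⟩
    have hxt : ∀ e ∈ E, ∀ t, t ≤ len14 E' e → W.countP (fun v => v.1 = dN14 e t) = x e := by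
      intro e he t
      induction t with
      | zero => intro _; exact (hx e).symm
      | succ t ih =>
        intro ht
        rw [← ih (by omega), hD]
        apply Multiset.countP_congr rfl
        intro v hv
        have hLe := hL e
        rcases hW' v hv with ⟨i, rfl⟩ | ⟨e', he', rfl | ⟨s, hs', rfl⟩ | rfl | rfl⟩
        · simp [ad_ne, bd_ne]
        · simp only [bd_ne]; rw [dN_inj (by omega) (by omega)]; simp
        · have := hL e'
          simp only
          rw [dN_inj (by omega) (by omega), dN_inj (by omega) (by omega)]
          simp
        · have := hL e'
          simp only [ad_ne]
          rw [dN_inj (by omega) (by omega)]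
          simp only [eq_iff_iff, false_iff]
          rintro ⟨rfl, h⟩; omega
        · simp [ad_ne, bd_ne]
    have hinA : ∀ i, W.countP (fun v => v.2 = aC i) = ∑ e ∈ E with e.1 = i, x e := by
      intro i
      rw [Finset.sum_congr rfl (fun e he => (hxt e (Finset.mem_filter.1 he).1 _ le_rfl).symm)]
      apply sum_countP
      intro v hv
      rw [Finset.sum_filter]
      rcases hW' v hv with ⟨i', rfl⟩ | ⟨e', he', rfl | ⟨s, hs', rfl⟩ | rfl | rfl⟩
      · simp [ba_ne, ad_ne]
      · simp [da_ne, bd_ne]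
      · have h0 := hL e'
        simp only [da_ne, if_false]
        symm; apply Finset.sum_eq_zero
        intro e he
        have := hL e
        rw [if_neg (c := _ = dN14 _ _), ite_self]
        rw [dN_inj (by omega) (by omega)]
        rintro ⟨rfl, h⟩; omega
      · have h0 := hL e'
        simp only [aC_inj, dN_inj (hL _) (hL _)]
        rw [Finset.sum_eq_single e']
        · simp
        · intro e _ hne; simp [hne.symm]
        · exact fun h => (h he').elim
      · simp [ba_ne, ad_ne]
    have houtB : ∀ j, W.countP (fun v => v.1 = bC j) = ∑ e ∈ E with e.2 = j, x e := by
      intro j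
      simp only [hx, hD]
      apply sum_countP
      intro v hv
      rw [Finset.sum_filter]
      rcases hW' v hv with ⟨i', rfl⟩ | ⟨e', he', rfl | ⟨s, hs', rfl⟩ | rfl | rfl⟩
      · simp [ab_ne, bd_ne]
      · simp only [bC_inj, dN_inj (Nat.zero_le n) (Nat.zero_le n)]
        rw [Finset.sum_eq_single e']
        · simp
        · intro e _ hne; simp [hne.symm]
        · exact fun h => (h he').elim
      · have h0 := hL e'
        simp only [db_ne, if_false]
        symm; apply Finset.sum_eq_zero
        intro e he
        rw [if_neg (c := _ = dN14 _ _), ite_self]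
        rw [dN_inj (by omega) (by omega)]
        simp
      · simp [db_ne, ad_ne]
      · simp [ab_ne, bd_ne]
    have hsplit : W.card = ∑ i, W.countP (fun v => v.1 = aC i) +
        (∑ j, W.countP (fun v => v.1 = bC j) +
        ∑ p ∈ E.sigma (fun e => Finset.range (len14 E' e + 1)),
          W.countP (fun v => v.1 = dN14 p.1 p.2)) := by
      have h := sum_countP W (Finset.univ.disjSum (Finset.univ.disjSum
        (E.sigma (fun e => Finset.range (len14 E' e + 1))))) (fun _ => True)
        (fun (c : Fin n ⊕ Fin n ⊕ (Σ _ : Fin n × Fin n, ℕ)) v => v.1 =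
          Sum.elim aC (Sum.elim bC (fun p => dN14 p.1 p.2)) c) ?_
      · rw [Finset.sum_disjSum, Finset.sum_disjSum] at h
        have hT : W.card = W.countP (fun _ => True) :=
          (Multiset.countP_eq_card.2 (fun _ _ => trivial)).symm
        exact hT.trans h
      intro v hv
      have key : ∀ e ∈ E, ∀ t ≤ len14 E' e,
          ∑ p ∈ E.sigma (fun e => Finset.range (len14 E' e + 1)),
          (if dN14 e t = dN14 p.1 p.2 then 1 else 0) = 1 := by
        intro e he t ht
        have h0 := hL e
        rw [Finset.sum_eq_single ⟨e, t⟩]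
        · simp
        · rintro ⟨e', t'⟩ hp hne
          simp only [Finset.mem_sigma, Finset.mem_range] at hp
          have := hL e'
          dsimp only
          rw [if_neg]
          rw [dN_inj (by omega) (by omega)]
          rintro ⟨rfl, rfl⟩; exact hne rfl
        · intro h; exact (h (by simp [he]; omega)).elim
      simp only [Finset.sum_disjSum, Sum.elim_inl, Sum.elim_inr, if_true]
      rcases hW' v hv with ⟨i', rfl⟩ | ⟨e', he', rfl | ⟨s, hs', rfl⟩ | rfl | rfl⟩
      · simp [aC_inj, ab_ne, ad_ne]
      · simp [bC_inj, ba_ne, bd_ne]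
      · simp only [da_ne, db_ne, if_false, Finset.sum_const_zero, zero_add]
        exact (key e' he' s hs'.le).symm.trans (by congr)
      · simp only [da_ne, db_ne, if_false, Finset.sum_const_zero, zero_add]
        exact (key e' he' _ le_rfl).symm.trans (by congr)
      · simp [aC_inj, ab_ne, ad_ne]
    have hXB : ∑ j, W.countP (fun v => v.1 = bC j) = ∑ e ∈ E, x e := by
      simp only [houtB]
      exact Finset.sum_fiberwise E (fun e => e.2) x
    have hXA : ∑ i, W.countP (fun v => v.1 = aC i) + n = ∑ e ∈ E, x e := by
      rw [← Finset.sum_fiberwise E (fun e => e.1) x]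
      simp only [← hinA, hA, Finset.sum_add_distrib]
      simp
    have hXD : ∑ p ∈ E.sigma (fun e => Finset.range (len14 E' e + 1)),
          W.countP (fun v => v.1 = dN14 p.1 p.2) =
          n * ∑ e ∈ E, x e + ∑ e ∈ E, if e ∈ E' then x e else 0 := by
      rw [Finset.sum_sigma, Finset.mul_sum, ← Finset.sum_add_distrib]
      apply Finset.sum_congr rfl
      intro e he
      rw [Finset.sum_congr rfl (fun t ht => hxt e he t (by simp at ht; omega))]
      simp only [Finset.sum_const, Finset.card_range, smul_eq_mul]
      unfold len14
      split_ifs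
      · ring
      · rw [Nat.sub_add_cancel hn]; ring
    rw [hXB, hXD, hcard, ← hXA] at hsplit
    set Y := ∑ i, W.countP (fun v => v.1 = aC i) with hY
    set R := ∑ e ∈ E, if e ∈ E' then x e else 0 with hR
    have hY0 : Y = 0 := by
      by_contra h
      have : 1 ≤ Y := by omega
      nlinarith
    have hRk : R = k := by rw [hY0] at hsplit; nlinarith
    have hYi : ∀ i, W.countP (fun v => v.1 = aC i) = 0 := by
      intro i
      exact (Finset.sum_eq_zero_iff.1 (hY.symm.trans hY0)) i (Finset.mem_univ i)
    have hBi : ∀ j, W.countP (fun v => v.2 = bC j) = 0 := by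
      intro j
      rw [Multiset.countP_eq_zero]
      intro v hv
      rcases hW' v hv with ⟨i', rfl⟩ | ⟨e', he', rfl | ⟨s, hs', rfl⟩ | rfl | rfl⟩
      · exact ((Multiset.countP_eq_zero.1 (hYi i')) _ hv rfl).elim
      · simp [db_ne]
      · simp [db_ne]
      · simp [ab_ne]
      · exact ((Multiset.countP_eq_zero.1 (hYi e'.1)) _ hv rfl).elim
    have h1 : ∀ i, ∑ e ∈ E with e.1 = i, x e = 1 := by
      intro i; rw [← hinA, hA, hYi]
    have h2 : ∀ j, ∑ e ∈ E with e.2 = j, x e = 1 := by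
      intro j; rw [← houtB, hB, hBi]
    have hx1 : ∀ e ∈ E, x e = if x e ≠ 0 then 1 else 0 := by
      intro e he
      have : x e ≤ ∑ e' ∈ E with e'.1 = e.1, x e' :=
        Finset.single_le_sum (f := x) (fun _ _ => Nat.zero_le _) (by simp [he])
      rw [h1] at this
      split_ifs <;> omega
    refine ⟨E.filter (fun e => x e ≠ 0), Finset.filter_subset _ _, ?_, ?_, ?_⟩
    · intro i
      rw [← h1 i, Finset.filter_comm, Finset.card_filter]
      exact Finset.sum_congr rfl (fun e he => (hx1 e (Finset.mem_filter.1 he).1).symm)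
    · intro i
      rw [← h2 i, Finset.filter_comm, Finset.card_filter]
      exact Finset.sum_congr rfl (fun e he => (hx1 e (Finset.mem_filter.1 he).1).symm)
    · rw [← hRk, hR, ← Finset.sum_filter, ← Finset.filter_mem_eq_inter, Finset.filter_comm,
        Finset.card_filter]
      exact Finset.sum_congr rfl (fun e he => (hx1 e (Finset.mem_filter.1 he).1).symm)
  · rintro ⟨F, hFE, h1, h2, h3⟩
    have hFn : F.card = n := by
      rw [Finset.card_eq_sum_card_fiberwise (f := Prod.fst) (t := Finset.univ) (by simp)]
      simp [h1]
    have hW : ∀ v ∈ F.val.bind (fun e => path14 (len14 E' e) e), v ∈ votes14 E E' := by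
      intro v hv
      rw [Multiset.mem_bind] at hv
      obtain ⟨e, he, hv⟩ := hv
      rw [votes_eq, Multiset.mem_add, Multiset.mem_bind]
      exact Or.inr ⟨e, hFE he, Multiset.mem_add.2 (Or.inl hv)⟩
    refine ⟨F.val.bind (fun e => path14 (len14 E' e) e), ?_, hW, (hmain _ hW).2 ?_⟩
    · rw [Multiset.card_bind]
      have : ∀ e, (Multiset.card ∘ fun e => path14 (len14 E' e) e) e =
          (n + 1) + if e ∈ E' then 1 else 0 := by
        intro e
        simp only [Function.comp, card_path, len14]
        split_ifs <;> omega
      rw [Multiset.map_congr rfl (fun e _ => this e)]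
      change ∑ e ∈ F, _ = _
      rw [Finset.sum_add_distrib, ← Finset.card_filter, Finset.filter_mem_eq_inter, h3]
      simp [hFn]
    · intro c
      rw [score_votes, score_bind]
      simp only [score_path, Finset.sum_sub_distrib]
      have ea : ∑ e ∈ F, (if aC e.1 = c then (1 : ℤ) else 0) = ∑ i, if aC i = c then (1 : ℤ) else 0 := by
        rw [← Finset.sum_fiberwise F (fun e => e.1)]
        apply Finset.sum_congr rfl
        intro i _
        rw [Finset.sum_congr rfl (g := fun _ => if aC i = c then (1 : ℤ) else 0)
          (fun e he => by rw [(Finset.mem_filter.1 he).2])]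
        rw [Finset.sum_const, h1, one_smul]
      have eb : ∑ e ∈ F, (if bC e.2 = c then (1 : ℤ) else 0) = ∑ i, if bC i = c then (1 : ℤ) else 0 := by
        rw [← Finset.sum_fiberwise F (fun e => e.2)]
        apply Finset.sum_congr rfl
        intro i _
        rw [Finset.sum_congr rfl (g := fun _ => if bC i = c then (1 : ℤ) else 0)
          (fun e he => by rw [(Finset.mem_filter.1 he).2])]
        rw [Finset.sum_const, h2, one_smul]
      rw [ea, eb]
      ring
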